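/- arXiv:2312.14323 — 2 statements merged into one kernel-verified Lean document; each statement's English description precedes it below -/
import Mathlib

section
/- Let 0 ≤ l ≤ n be integers and let f₁, …, f_n be 2π-periodic functions, each with absolutely convergent Fourier series and with Σ_k |k||f̂_j(k)| < ∞ for every j (so each f_j is C¹ with absolutely convergent derivative series). Define I(α) = pv ∫_𝕋 Π_{j=1}^{l} f_j(α−β) · Π_{j=l+1}^{n} Δ_βf_j(α) · dβ/(2 sin(β/2)) and J(α) = pv ∫_𝕋 Π_{j=1}^{l} f_j(α−β) · Π_{j=l+1}^{n} Δ_βf_j(α) · dβ/(2 tan(β/2)). Then the principal values exist for every α, and the Fourier coefficients satisfy, for every k ∈ ℤ, |Î(k)| ≤ 4 [(∗_{j=1}^{l} |f̂_j|) ∗ (∗_{j=l+1}^{n} |·||f̂_j|)](k) and |Ĵ(k)| ≤ (10/3) [(∗_{j=1}^{l} |f̂_j|) ∗ (∗_{j=l+1}^{n} |·||f̂_j|)](k), where ∗ denotes convolution of sequences over ℤ and |·||f̂_j| denotes the sequence k ↦ |k||f̂_j(k)|. -/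
open MeasureTheory Filter

/-- The `k`-th Fourier coefficient of a `2π`-periodic function `f : ℝ → ℂ`. -/
noncomputable def cFourierCoef (f : ℝ → ℂ) (k : ℤ) : ℂ :=
  (1 / (2 * Real.pi)) * ∫ α in (-Real.pi)..Real.pi, f α * Complex.exp (-Complex.I * k * α)

/-- Convolution of two `[0,∞]`-valued sequences over `ℤ`. -/
noncomputable def convZ (a b : ℤ → ENNReal) : ℤ → ENNReal :=
  fun k => ∑' m : ℤ, a m * b (k - m)

/-- The Dirac sequence at `0`, the unit for convolution. -/
noncomputable def deltaZ : ℤ → ENNReal := fun k => if k = 0 then 1 else 0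

/-- The finite difference quotient `Δ_β f(α) = (f(α-β) - f(α))/(2 sin(β/2))`. -/
noncomputable def deltaBeta (f : ℝ → ℂ) (β α : ℝ) : ℂ :=
  (f (α - β) - f α) / ((2 * Real.sin (β / 2) : ℝ) : ℂ)

/-- The product `Π_{j=1}^l f_j(α-β) · Π_{j=l+1}^n Δ_β f_j(α)` (indices `j < l`
correspond to the first group). -/
noncomputable def prodKer (n l : ℕ) (f : Fin n → ℝ → ℂ) (α β : ℝ) : ℂ :=
  ∏ j : Fin n, if (j : ℕ) < l then f j (α - β) else deltaBeta (f j) β α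

/-- Truncated version of the principal value integral
`pv ∫_𝕋 prodKer · dβ/(2 sin(β/2))`. -/
noncomputable def pvSinApprox (n l : ℕ) (f : Fin n → ℝ → ℂ) (α ε : ℝ) : ℂ :=
  (∫ β in ε..Real.pi, prodKer n l f α β / ((2 * Real.sin (β / 2) : ℝ) : ℂ)) +
    ∫ β in (-Real.pi)..(-ε), prodKer n l f α β / ((2 * Real.sin (β / 2) : ℝ) : ℂ)

/-- Truncated version of the principal value integral
`pv ∫_𝕋 prodKer · dβ/(2 tan(β/2))`. -/
noncomputable def pvTanApprox (n l : ℕ) (f : Fin n → ℝ → ℂ) (α ε : ℝ) : ℂ :=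
  (∫ β in ε..Real.pi, prodKer n l f α β / ((2 * Real.tan (β / 2) : ℝ) : ℂ)) +
    ∫ β in (-Real.pi)..(-ε), prodKer n l f α β / ((2 * Real.tan (β / 2) : ℝ) : ℂ)

/-- The convolution `(∗_{j=1}^l |f̂_j|) ∗ (∗_{j=l+1}^n |·||f̂_j|)` of the
absolute-value sequences of Fourier coefficients. -/
noncomputable def convBound (n l : ℕ) (f : Fin n → ℝ → ℂ) : ℤ → ENNReal :=
  (List.ofFn fun j : Fin n => fun k : ℤ =>
      if (j : ℕ) < l then ENNReal.ofReal (‖cFourierCoef (f j) k‖)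
      else ENNReal.ofReal (|(k : ℝ)| * ‖cFourierCoef (f j) k‖)).foldr convZ deltaZ

open Complex (I)

/-- `HasTrigRep G B` says that `G α β` is, off the zeros of `sin (β / 2)`, an absolutely convergent
sum of terms `c * exp (I p α) * exp (I q β / 2)` with `p, q ∈ ℤ`, such that for every `m` the terms
with `p = m` have total weight at most `B m`. -/
def HasTrigRep (G : ℝ → ℝ → ℂ) (B : ℤ → ENNReal) : Prop :=
  ∃ (ι : Type) (_ : Countable ι) (c : ι → ℂ) (p q : ι → ℤ),
    Summable (fun i => ‖c i‖) ∧ (∀ m, ∑' i, (if p i = m then ‖c i‖ₑ else 0) ≤ B m) ∧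
    ∀ α β : ℝ, Real.sin (β / 2) ≠ 0 →
      HasSum (fun i => c i * Complex.exp (I * p i * α) * Complex.exp (I * q i * (β / 2))) (G α β)

theorem norm_cexp_I_mul_int_mul (p : ℤ) (x : ℝ) : ‖Complex.exp (I * p * x)‖ = 1 := by
  rw [Complex.norm_exp]; simp

theorem norm_cexp_I_mul_int_mul_half (p : ℤ) (x : ℝ) : ‖Complex.exp (I * p * (x / 2))‖ = 1 := by
  have := norm_cexp_I_mul_int_mul p (x / 2)
  push_cast at this
  exact this

theorem hasTrigRep_one : HasTrigRep (fun _ _ => 1) deltaZ := by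
  refine ⟨Unit, inferInstance, fun _ => 1, fun _ => 0, fun _ => 0, (hasSum_fintype _).summable, ?_, ?_⟩
  · intro m
    simp [deltaZ, eq_comm]
  · intro α β _
    simp

theorem HasTrigRep.mul {G H : ℝ → ℝ → ℂ} {A B : ℤ → ENNReal} (hG : HasTrigRep G A)
    (hH : HasTrigRep H B) : HasTrigRep (fun α β => G α β * H α β) (convZ A B) := by
  obtain ⟨ι, _, c, p, q, hc, hA, hG⟩ := hG
  obtain ⟨κ, _, d, r, s, hd, hB, hH⟩ := hH
  refine ⟨ι × κ, inferInstance, fun x => c x.1 * d x.2, fun x => p x.1 + r x.2,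
    fun x => q x.1 + s x.2, hc.mul_norm hd, ?_, ?_⟩
  · intro m
    calc ∑' x : ι × κ, (if p x.1 + r x.2 = m then ‖c x.1 * d x.2‖ₑ else 0)
        = ∑' i, ‖c i‖ₑ * ∑' j, (if r j = m - p i then ‖d j‖ₑ else 0) := by
          rw [ENNReal.tsum_prod']
          refine tsum_congr fun i => ?_
          rw [← ENNReal.tsum_mul_left]
          refine tsum_congr fun j => ?_
          simp only [eq_sub_iff_add_eq', enorm_mul, mul_ite, mul_zero]
      _ ≤ ∑' i, ‖c i‖ₑ * B (m - p i) := by gcongr; exact hB _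
      _ = ∑' i, ∑' n, (if p i = n then ‖c i‖ₑ else 0) * B (m - n) := by
          refine tsum_congr fun i => ?_
          rw [tsum_eq_single (p i)]
          · simp
          · intro n hn
            simp [hn.symm]
      _ = ∑' n, (∑' i, (if p i = n then ‖c i‖ₑ else 0)) * B (m - n) := by
          rw [ENNReal.tsum_comm]
          simp_rw [ENNReal.tsum_mul_right]
      _ ≤ ∑' n, A n * B (m - n) := by gcongr; exact hA _
  · intro α β hβ
    have hsc : Summable fun i => ‖c i * Complex.exp (I * p i * α) * Complex.exp (I * q i * (β / 2))‖ := by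
      simpa only [norm_mul, norm_cexp_I_mul_int_mul, norm_cexp_I_mul_int_mul_half, mul_one] using hc
    have hsd : Summable fun i => ‖d i * Complex.exp (I * r i * α) * Complex.exp (I * s i * (β / 2))‖ := by
      simpa only [norm_mul, norm_cexp_I_mul_int_mul, norm_cexp_I_mul_int_mul_half, mul_one] using hd
    have hsum := summable_mul_of_summable_norm hsc hsd
    have hmul := (hG α β hβ).mul (hH α β hβ) hsum
    convert! hmul using 2 with x
    push_cast
    rw [mul_add, add_mul, Complex.exp_add, mul_add I, add_mul _ _ ((β : ℂ) / 2), Complex.exp_add]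
    ring

theorem HasTrigRep.prod {n : ℕ} {G : Fin n → ℝ → ℝ → ℂ} {B : Fin n → ℤ → ENNReal}
    (h : ∀ j, HasTrigRep (G j) (B j)) :
    HasTrigRep (fun α β => ∏ j, G j α β) ((List.ofFn B).foldr convZ deltaZ) := by
  induction n with
  | zero => simpa using hasTrigRep_one
  | succ n ih =>
    simp only [Fin.prod_univ_succ, List.ofFn_succ, List.foldr_cons]
    exact (h 0).mul (ih fun j => h j.succ)

/-- A continuous periodic function is the sum of its Fourier series if the latter converges
absolutely. -/
theorem hasSum_cFourierCoef {f : ℝ → ℂ} (hper : Function.Periodic f (2 * Real.pi))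
    (hcont : Continuous f) (hsum : Summable fun k : ℤ => ‖cFourierCoef f k‖) (x : ℝ) :
    HasSum (fun k : ℤ => cFourierCoef f k * Complex.exp (I * k * x)) (f x) := by
  have : Fact (0 < 2 * Real.pi) := ⟨Real.two_pi_pos⟩
  have hpi : (Real.pi : ℂ) ≠ 0 := by exact_mod_cast Real.pi_ne_zero
  let F : C(AddCircle (2 * Real.pi), ℂ) := ⟨hper.lift, continuous_coinduced_dom.mpr hcont⟩
  have hF : ∀ y : ℝ, F (y : AddCircle (2 * Real.pi)) = f y := fun y => hper.lift_coe y
  have hcoef : ∀ k, fourierCoeff F k = cFourierCoef f k := by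
    intro k
    rw [fourierCoeff_eq_intervalIntegral _ _ (-Real.pi), cFourierCoef]
    rw [show -Real.pi + 2 * Real.pi = Real.pi by ring, Complex.real_smul]
    congr 1
    · push_cast; rfl
    · refine intervalIntegral.integral_congr fun y _ => ?_
      simp only [fourier_coe_apply, hF, smul_eq_mul]
      rw [mul_comm]
      congr 2
      push_cast
      field_simp
  have := has_pointwise_sum_fourier_series_of_summable (f := F)
    (by rw [funext hcoef]; exact hsum.of_norm) (x : AddCircle (2 * Real.pi))
  rw [hF] at this
  convert! this using 2 with k
  rw [hcoef, fourier_coe_apply, smul_eq_mul]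
  congr 2
  push_cast
  field_simp

theorem hasTrigRep_shift {f : ℝ → ℂ} (hper : Function.Periodic f (2 * Real.pi))
    (hcont : Continuous f) (hsum : Summable fun k : ℤ => ‖cFourierCoef f k‖) :
    HasTrigRep (fun α β => f (α - β)) fun k => ENNReal.ofReal ‖cFourierCoef f k‖ := by
  refine ⟨ℤ, inferInstance, cFourierCoef f, id, fun k => -2 * k, hsum, ?_, ?_⟩
  · intro m
    rw [tsum_eq_single m]
    · simp
    · intro k hk
      simp [hk]
  · intro α β _
    convert! hasSum_cFourierCoef hper hcont hsum (α - β) using 2 with k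
    rw [mul_assoc, ← Complex.exp_add]
    congr 2
    push_cast [id]
    ring

/-- The difference quotient of `exp (I k ·)` as a sum of `|k|` exponentials. -/
theorem cexp_sub_one_div_two_sin (k : ℤ) {β : ℝ} (hβ : Real.sin (β / 2) ≠ 0) :
    (Complex.exp (-(I * k * β)) - 1) / ((2 * Real.sin (β / 2) : ℝ) : ℂ) =
      ∑ s : Fin k.natAbs, -I * (k.sign : ℂ) *
        Complex.exp (I * ((-k.sign * (1 + 2 * (s : ℕ)) : ℤ) : ℂ) * (β / 2)) := by
  have hs : ((2 * Real.sin (β / 2) : ℝ) : ℂ) ≠ 0 := by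
    exact_mod_cast mul_ne_zero two_ne_zero hβ
  have key : ∀ σ : ℤ, σ = 1 ∨ σ = -1 →
      (Complex.exp (-(I * σ * β)) - 1) = -I * σ * Complex.exp (-(I * σ * (β / 2))) *
        ((2 * Real.sin (β / 2) : ℝ) : ℂ) := by
    intro σ hσ
    have h1 : Complex.exp (I * (β / 2)) * Complex.exp (-(I * (β / 2))) = 1 := by
      rw [← Complex.exp_add]; simp
    have h2 : ((2 * Real.sin (β / 2) : ℝ) : ℂ) =
        (Complex.exp (-(I * (β / 2))) - Complex.exp (I * (β / 2))) * I := by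
      push_cast
      rw [Complex.sin]
      ring_nf
    have h3 : Complex.exp (I * β) = Complex.exp (I * (β / 2)) * Complex.exp (I * (β / 2)) := by
      rw [← Complex.exp_add]; ring_nf
    have h4 : Complex.exp (-(I * β)) = Complex.exp (-(I * (β / 2))) * Complex.exp (-(I * (β / 2))) := by
      rw [← Complex.exp_add]; ring_nf
    rcases hσ with rfl | rfl
    · simp only [Int.cast_one, mul_one, h2, h4]
      linear_combination (1 : ℂ) * h1 + Complex.exp (-(I * (β / 2))) * (Complex.exp (-(I * (β / 2))) - Complex.exp (I * (β / 2))) * Complex.I_sq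
    · simp only [Int.cast_neg, Int.cast_one, mul_neg, mul_one, neg_mul, neg_neg, h2, h3]
      linear_combination (1 : ℂ) * h1 - Complex.exp (I * (β / 2)) * (Complex.exp (-(I * (β / 2))) - Complex.exp (I * (β / 2))) * Complex.I_sq
  rcases eq_or_ne k 0 with rfl | hk
  · simp
  have hsign : k.sign = 1 ∨ k.sign = -1 := by
    rcases lt_or_gt_of_ne hk with h | h
    · exact Or.inr (Int.sign_eq_neg_one_of_neg h)
    · exact Or.inl (Int.sign_eq_one_of_pos h)
  have hpow : Complex.exp (-(I * k * β)) = Complex.exp (-(I * k.sign * β)) ^ k.natAbs := by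
    rw [← Complex.exp_nat_mul]
    congr 1
    have : (k : ℂ) = k.sign * (k.natAbs : ℂ) := by
      have h := congrArg (Int.cast (R := ℂ)) (Int.sign_mul_natAbs k)
      rw [Int.cast_mul, Int.cast_natCast] at h
      exact h.symm
    rw [this]
    ring
  rw [hpow, ← geom_sum_mul, key _ hsign, div_eq_iff hs, ← Fin.sum_univ_eq_sum_range
    (fun s => Complex.exp (-(I * k.sign * β)) ^ s), ← mul_assoc, Finset.sum_mul]
  congr 1
  refine Finset.sum_congr rfl fun s _ => ?_
  rw [← Complex.exp_nat_mul, mul_left_comm, ← Complex.exp_add]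
  congr 2
  push_cast
  ring

theorem hasTrigRep_deltaBeta {f : ℝ → ℂ} (hper : Function.Periodic f (2 * Real.pi))
    (hcont : Continuous f) (hsum : Summable fun k : ℤ => ‖cFourierCoef f k‖)
    (hsum' : Summable fun k : ℤ => |(k : ℝ)| * ‖cFourierCoef f k‖) :
    HasTrigRep (fun α β => deltaBeta f β α)
      fun k => ENNReal.ofReal (|(k : ℝ)| * ‖cFourierCoef f k‖) := by
  have hnorm : ∀ (k : ℤ) (_ : Fin k.natAbs),
      ‖cFourierCoef f k * (-I * (k.sign : ℂ))‖ = ‖cFourierCoef f k‖ := by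
    intro k s
    have hk : k ≠ 0 := by
      rintro rfl
      exact s.elim0
    rcases lt_or_gt_of_ne hk with h | h
    · simp [Int.sign_eq_neg_one_of_neg h]
    · simp [Int.sign_eq_one_of_pos h]
  have hsc : Summable fun x : (k : ℤ) × Fin k.natAbs =>
      ‖cFourierCoef f x.1 * (-I * (x.1.sign : ℂ))‖ := by
    rw [summable_sigma_of_nonneg fun _ => norm_nonneg _]
    refine ⟨fun k => (hasSum_fintype _).summable, ?_⟩
    convert! hsum' using 2 with k
    rw [tsum_fintype, Finset.sum_congr rfl fun s _ => hnorm k s]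
    simp [Nat.cast_natAbs]
  refine ⟨(k : ℤ) × Fin k.natAbs, inferInstance,
    fun x => cFourierCoef f x.1 * (-I * (x.1.sign : ℂ)), fun x => x.1,
    fun x => -x.1.sign * (1 + 2 * (x.2 : ℕ)), hsc, ?_, ?_⟩
  · intro m
    rw [ENNReal.tsum_sigma', tsum_eq_single m]
    · simp only [if_true]
      rw [tsum_fintype, Finset.sum_congr rfl fun s _ => by
        rw [← ofReal_norm, hnorm m s]]
      rw [ENNReal.ofReal_mul (abs_nonneg _)]
      simp only [Finset.sum_const, Finset.card_univ, Fintype.card_fin, nsmul_eq_mul]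
      rw [← ENNReal.ofReal_natCast, Nat.cast_natAbs, Int.cast_abs]
    · intro k hk
      simp [hk]
  · intro α β hβ
    have h1 := hasSum_cFourierCoef hper hcont hsum (α - β)
    have h2 := hasSum_cFourierCoef hper hcont hsum α
    have h3 := (h1.sub h2).div_const ((2 * Real.sin (β / 2) : ℝ) : ℂ)
    have h4 : Summable fun x : (k : ℤ) × Fin k.natAbs =>
      cFourierCoef f x.1 * (-I * (x.1.sign : ℂ)) * Complex.exp (I * x.1 * α) *
        Complex.exp (I * ((-x.1.sign * (1 + 2 * (x.2 : ℕ)) : ℤ) : ℂ) * (β / 2)) := by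
      refine Summable.of_norm ?_
      simpa only [norm_mul _ (Complex.exp _), norm_cexp_I_mul_int_mul,
        norm_cexp_I_mul_int_mul_half, mul_one] using hsc
    have h5 := h4.hasSum.sigma fun k => hasSum_fintype _
    have h6 : ∀ k : ℤ, (cFourierCoef f k * Complex.exp (I * k * ((α - β : ℝ) : ℂ)) -
        cFourierCoef f k * Complex.exp (I * k * α)) / ((2 * Real.sin (β / 2) : ℝ) : ℂ) =
        ∑ s : Fin k.natAbs, cFourierCoef f k * (-I * (k.sign : ℂ)) * Complex.exp (I * k * α) *
          Complex.exp (I * ((-k.sign * (1 + 2 * (s : ℕ)) : ℤ) : ℂ) * (β / 2)) := by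
      intro k
      have h7 : Complex.exp (I * k * ((α - β : ℝ) : ℂ)) =
          Complex.exp (I * k * α) * Complex.exp (-(I * k * β)) := by
        rw [← Complex.exp_add]
        push_cast
        ring_nf
      rw [h7, show ∀ a b c d : ℂ, (a * (b * c) - a * b) / d = a * b * ((c - 1) / d) by
        intros; ring, cexp_sub_one_div_two_sin k hβ, Finset.mul_sum]
      exact Finset.sum_congr rfl fun s _ => by ring
    simp only [deltaBeta]
    rw [h3.unique (by simpa only [h6] using h5)]
    exact h4.hasSum

/-- The integral of `K` against `f` over `ε < |β| < π`. -/
noncomputable def truncIntegral (K : ℝ → ℝ) (f : ℝ → ℂ) (ε : ℝ) : ℂ :=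
  (∫ β in ε..Real.pi, f β * (K β : ℂ)) + ∫ β in (-Real.pi)..(-ε), f β * (K β : ℂ)

/-- An odd kernel on `[-π, π]`, continuous away from `0`, whose sine integrals over `[ε, π]` are
uniformly bounded and converge as `ε → 0⁺` to limits bounded by `M`. -/
structure OddKernel (K : ℝ → ℝ) (a : ℤ → ℝ) (M : ℝ) : Prop where
  odd : ∀ β, K (-β) = -K β
  continuousOn : ContinuousOn K (Set.Ioc 0 Real.pi)
  bounded : ∃ C, ∀ (q : ℤ) (ε : ℝ), 0 < ε → ε ≤ Real.pi →
    |∫ β in ε..Real.pi, 2 * Real.sin (q * (β / 2)) * K β| ≤ C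
  tendsto : ∀ q : ℤ, Tendsto (fun ε => ∫ β in ε..Real.pi, 2 * Real.sin (q * (β / 2)) * K β)
    (nhdsWithin 0 (Set.Ioi 0)) (nhds (a q))
  le : ∀ q, |a q| ≤ M

theorem sin_half_ne_zero {β : ℝ} (h0 : 0 < β) (hpi : β ≤ Real.pi) : Real.sin (β / 2) ≠ 0 :=
  (Real.sin_pos_of_pos_of_lt_pi (by linarith) (by linarith)).ne'

theorem OddKernel.hasSum_integral {K : ℝ → ℝ} {a : ℤ → ℝ} {M : ℝ} (hK : OddKernel K a M)
    {ι : Type} [Countable ι] {c : ι → ℂ} (hc : Summable fun i => ‖c i‖) (q : ι → ℤ) {g : ℝ → ℂ}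
    {ε : ℝ} (h0 : 0 < ε) (hpi : ε ≤ Real.pi)
    (hg : ∀ β, 0 < β → β ≤ Real.pi → HasSum (fun i => c i * Complex.exp (I * q i * (β / 2))) (g β)) :
    HasSum (fun i => c i * ∫ β in ε..Real.pi, Complex.exp (I * q i * (β / 2)) * (K β : ℂ))
      (∫ β in ε..Real.pi, g β * (K β : ℂ)) := by
  have hsub : Set.uIcc ε Real.pi ⊆ Set.Ioc 0 Real.pi := by
    rw [Set.uIcc_of_le hpi]
    exact fun x hx => ⟨h0.trans_le hx.1, hx.2⟩
  have hKc : ContinuousOn K (Set.uIcc ε Real.pi) := hK.continuousOn.mono hsub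
  simp_rw [← intervalIntegral.integral_const_mul]
  refine intervalIntegral.hasSum_integral_of_dominated_convergence (fun i β => ‖c i‖ * |K β|)
    ?_ ?_ ?_ ?_ ?_
  · intro i
    refine ContinuousOn.aestronglyMeasurable ?_ measurableSet_uIoc
    have hKc' : ContinuousOn (fun β => (K β : ℂ)) (Set.uIoc ε Real.pi) :=
      Complex.continuous_ofReal.comp_continuousOn (hKc.mono Set.uIoc_subset_uIcc)
    have : Continuous fun β : ℝ => Complex.exp (I * q i * (β / 2)) := by fun_prop
    exact continuousOn_const.mul (this.continuousOn.mul hKc')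
  · intro i
    refine ae_of_all _ fun β _ => ?_
    rw [norm_mul, norm_mul, norm_cexp_I_mul_int_mul_half, one_mul, Complex.norm_real,
      Real.norm_eq_abs]
  · exact ae_of_all _ fun β _ => hc.mul_right _
  · simp_rw [tsum_mul_right]
    exact (continuousOn_const.mul hKc.abs).intervalIntegrable
  · refine ae_of_all _ fun β hβ => ?_
    have := hsub (Set.uIoc_subset_uIcc hβ)
    simpa only [mul_assoc] using (hg β this.1 this.2).mul_right (K β : ℂ)

theorem OddKernel.integral_cexp_sub {K : ℝ → ℝ} {a : ℤ → ℝ} {M : ℝ} (hK : OddKernel K a M)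
    (q : ℤ) {ε : ℝ} (h0 : 0 < ε) (hpi : ε ≤ Real.pi) :
    (∫ β in ε..Real.pi, Complex.exp (I * q * (β / 2)) * (K β : ℂ)) -
      ∫ β in ε..Real.pi, Complex.exp (I * (-q : ℤ) * (β / 2)) * (K β : ℂ) =
      I * (∫ β in ε..Real.pi, 2 * Real.sin (q * (β / 2)) * K β : ℝ) := by
  have hsub : Set.uIcc ε Real.pi ⊆ Set.Ioc 0 Real.pi := by
    rw [Set.uIcc_of_le hpi]
    exact fun x hx => ⟨h0.trans_le hx.1, hx.2⟩
  have hKc : ContinuousOn (fun β => (K β : ℂ)) (Set.uIcc ε Real.pi) :=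
    Complex.continuous_ofReal.comp_continuousOn (hK.continuousOn.mono hsub)
  have hexp : ∀ r : ℤ, IntervalIntegrable
      (fun β : ℝ => Complex.exp (I * r * (β / 2)) * (K β : ℂ)) volume ε Real.pi := by
    intro r
    have : Continuous fun β : ℝ => Complex.exp (I * r * (β / 2)) := by fun_prop
    exact (this.continuousOn.mul hKc).intervalIntegrable
  rw [← intervalIntegral.integral_sub (hexp _) (hexp _), ← intervalIntegral.integral_ofReal,
    ← intervalIntegral.integral_const_mul]
  refine intervalIntegral.integral_congr fun β _ => ?_
  push_cast
  simp only [Complex.sin]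
  have h1 : Complex.exp (I * q * (β / 2)) = Complex.exp (q * (β / 2) * I) := by ring_nf
  have h2 : Complex.exp (I * -q * (β / 2)) = Complex.exp (-(q * (β / 2)) * I) := by ring_nf
  rw [h1, h2]
  linear_combination (Complex.exp (q * (β / 2) * I) - Complex.exp (-(q * (β / 2)) * I)) * K β *
    Complex.I_sq

/-- The truncated integral of a trigonometric series, computed term by term. -/
theorem OddKernel.hasSum_truncIntegral {K : ℝ → ℝ} {a : ℤ → ℝ} {M : ℝ} (hK : OddKernel K a M)
    {ι : Type} [Countable ι] {c : ι → ℂ} (hc : Summable fun i => ‖c i‖) (q : ι → ℤ) {g : ℝ → ℂ}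
    (hg : ∀ β : ℝ, Real.sin (β / 2) ≠ 0 →
      HasSum (fun i => c i * Complex.exp (I * q i * (β / 2))) (g β))
    {ε : ℝ} (h0 : 0 < ε) (hpi : ε ≤ Real.pi) :
    HasSum (fun i => c i * (I * (∫ β in ε..Real.pi, 2 * Real.sin (q i * (β / 2)) * K β : ℝ)))
      (truncIntegral K g ε) := by
  have h1 := hK.hasSum_integral hc q h0 hpi fun β hβ0 hβ => hg β (sin_half_ne_zero hβ0 hβ)
  have h2 := hK.hasSum_integral hc (fun i => -q i) (g := fun β => g (-β)) h0 hpi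
    fun β hβ0 hβ => by
      have hs : Real.sin (-β / 2) ≠ 0 := by
        rw [neg_div, Real.sin_neg, neg_ne_zero]
        exact sin_half_ne_zero hβ0 hβ
      convert! hg (-β) hs using 4
      push_cast
      ring
  have h3 : truncIntegral K g ε = (∫ β in ε..Real.pi, g β * (K β : ℂ)) -
      ∫ β in ε..Real.pi, g (-β) * (K β : ℂ) := by
    rw [truncIntegral, sub_eq_add_neg, ← intervalIntegral.integral_neg]
    congr 1
    rw [← intervalIntegral.integral_comp_neg]
    refine intervalIntegral.integral_congr fun β _ => ?_
    simp [hK.odd]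
  rw [h3]
  convert! h1.sub h2 using 2 with i
  rw [← mul_sub, hK.integral_cexp_sub _ h0 hpi]

theorem cFourierCoef_cexp (p k : ℤ) :
    cFourierCoef (fun α => Complex.exp (I * p * α)) k = if p = k then 1 else 0 := by
  have hpi : (Real.pi : ℂ) ≠ 0 := by exact_mod_cast Real.pi_ne_zero
  have h : ∀ α : ℝ, Complex.exp (I * p * α) * Complex.exp (-I * k * α) =
      Complex.exp (I * (p - k : ℤ) * α) := by
    intro α
    rw [← Complex.exp_add]
    push_cast
    ring_nf
  simp only [cFourierCoef, h]
  split_ifs with hpk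
  · subst hpk
    simp
    field_simp
    ring
  · have hne : I * ((p - k : ℤ) : ℂ) ≠ 0 :=
      mul_ne_zero Complex.I_ne_zero (by exact_mod_cast sub_ne_zero.mpr hpk)
    rw [integral_exp_mul_complex hne]
    have hper : Complex.exp (I * (p - k : ℤ) * (Real.pi : ℝ)) =
        Complex.exp (I * (p - k : ℤ) * ((-Real.pi : ℝ) : ℂ)) := by
      rw [Complex.exp_eq_exp_iff_exists_int]
      exact ⟨p - k, by push_cast; ring⟩
    rw [hper]
    simp

theorem hasSum_cFourierCoef_of_hasSum {ι : Type} [Countable ι] {d : ι → ℂ} {p : ι → ℤ}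
    (hd : Summable fun i => ‖d i‖) {F : ℝ → ℂ}
    (hF : ∀ α : ℝ, HasSum (fun i => d i * Complex.exp (I * p i * α)) (F α)) (k : ℤ) :
    HasSum (fun i => if p i = k then d i else 0) (cFourierCoef F k) := by
  have h : HasSum (fun i => ∫ α in (-Real.pi)..Real.pi,
      d i * Complex.exp (I * p i * α) * Complex.exp (-I * k * α))
      (∫ α in (-Real.pi)..Real.pi, F α * Complex.exp (-I * k * α)) := by
    refine intervalIntegral.hasSum_integral_of_dominated_convergence (fun i _ => ‖d i‖)
      ?_ ?_ ?_ ?_ ?_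
    · intro i
      exact (by fun_prop : Continuous fun α : ℝ =>
        d i * Complex.exp (I * p i * α) * Complex.exp (-I * k * α)).aestronglyMeasurable
    · intro i
      refine ae_of_all _ fun α _ => le_of_eq ?_
      have := norm_cexp_I_mul_int_mul (-k) α
      push_cast at this
      rw [norm_mul, norm_mul, norm_cexp_I_mul_int_mul, neg_mul_comm, this, mul_one, mul_one]
    · exact ae_of_all _ fun _ _ => hd
    · exact intervalIntegrable_const
    · exact ae_of_all _ fun α _ => (hF α).mul_right _
  have h' := h.mul_left (1 / (2 * Real.pi) : ℂ)
  convert! h' using 2 with i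
  simp_rw [mul_assoc (d i)]
  rw [intervalIntegral.integral_const_mul, mul_left_comm]
  have := cFourierCoef_cexp (p i) k
  rw [cFourierCoef] at this
  rw [this, mul_ite, mul_one, mul_zero]

/-- Existence of the principal value, and the bound on its Fourier coefficients. -/
theorem HasTrigRep.tendsto_truncIntegral {G : ℝ → ℝ → ℂ} {B : ℤ → ENNReal} (hG : HasTrigRep G B)
    {K : ℝ → ℝ} {a : ℤ → ℝ} {M : ℝ} (hK : OddKernel K a M) :
    ∃ F : ℝ → ℂ, (∀ α, Tendsto (truncIntegral K (G α)) (nhdsWithin 0 (Set.Ioi 0)) (nhds (F α))) ∧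
      ∀ k, ENNReal.ofReal ‖cFourierCoef F k‖ ≤ ENNReal.ofReal M * B k := by
  obtain ⟨ι, _, c, p, q, hc, hB, hG⟩ := hG
  have hnorm : ∀ (α : ℝ) i, ‖c i * Complex.exp (I * p i * α)‖ = ‖c i‖ := fun α i => by
    rw [norm_mul, norm_cexp_I_mul_int_mul, mul_one]
  have hcM : ∀ i, ‖c i * (I * (a (q i) : ℂ))‖ ≤ ‖c i‖ * M := fun i => by
    rw [norm_mul, norm_mul, Complex.norm_I, one_mul, Complex.norm_real, Real.norm_eq_abs]
    exact mul_le_mul_of_nonneg_left (hK.le _) (norm_nonneg _)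
  have hd : Summable fun i => ‖c i * (I * (a (q i) : ℂ))‖ :=
    Summable.of_nonneg_of_le (fun _ => norm_nonneg _) hcM (hc.mul_right M)
  refine ⟨fun α => ∑' i, c i * Complex.exp (I * p i * α) * (I * (a (q i) : ℂ)), ?_, ?_⟩
  · intro α
    have hsum : ∀ ε ∈ Set.Ioc 0 Real.pi, truncIntegral K (G α) ε =
        ∑' i, c i * Complex.exp (I * p i * α) *
          (I * (∫ β in ε..Real.pi, 2 * Real.sin (q i * (β / 2)) * K β : ℝ)) := by
      intro ε hε
      exact (hK.hasSum_truncIntegral (by simpa only [hnorm] using hc) q (hG α) hε.1 hε.2).tsum_eq.symm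
    have hmem : Set.Ioc 0 Real.pi ∈ nhdsWithin (0 : ℝ) (Set.Ioi 0) := Ioc_mem_nhdsGT Real.pi_pos
    obtain ⟨C, hC⟩ := hK.bounded
    refine Tendsto.congr' (eventually_of_mem hmem fun ε hε => (hsum ε hε).symm) ?_
    refine tendsto_tsum_of_dominated_convergence (bound := fun i => ‖c i‖ * C)
      (hc.mul_right C) ?_ ?_
    · intro i
      refine Tendsto.const_mul _ (Tendsto.const_mul _ ?_)
      exact (Complex.continuous_ofReal.tendsto _).comp (hK.tendsto (q i))
    · refine eventually_of_mem hmem fun ε hε i => ?_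
      rw [norm_mul, hnorm, norm_mul, Complex.norm_I, one_mul, Complex.norm_real, Real.norm_eq_abs]
      exact mul_le_mul_of_nonneg_left (hC _ _ hε.1 hε.2) (norm_nonneg _)
  · intro k
    have hF : ∀ α : ℝ, HasSum (fun i => c i * (I * (a (q i) : ℂ)) * Complex.exp (I * p i * α))
        (∑' i, c i * Complex.exp (I * p i * α) * (I * (a (q i) : ℂ))) := by
      intro α
      simp_rw [mul_right_comm (c _) (Complex.exp _)]
      refine (Summable.of_norm ?_).hasSum
      simpa only [norm_mul _ (Complex.exp _), norm_cexp_I_mul_int_mul, mul_one] using hd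
    rw [← (hasSum_cFourierCoef_of_hasSum hd hF k).tsum_eq, ofReal_norm]
    calc ‖∑' i, (if p i = k then c i * (I * (a (q i) : ℂ)) else 0)‖ₑ
        ≤ ∑' i, ‖(if p i = k then c i * (I * (a (q i) : ℂ)) else 0)‖ₑ := enorm_tsum_le_tsum_enorm
      _ ≤ ∑' i, ENNReal.ofReal M * (if p i = k then ‖c i‖ₑ else 0) := by
          refine ENNReal.tsum_le_tsum fun i => ?_
          split_ifs
          · rw [← ofReal_norm, ← ofReal_norm, ← ENNReal.ofReal_mul' (norm_nonneg _), mul_comm M]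
            exact ENNReal.ofReal_le_ofReal (hcM i)
          · simp
      _ ≤ ENNReal.ofReal M * B k := by
          rw [ENNReal.tsum_mul_left]
          gcongr
          exact hB k

/-- The tail over `[ε, π]` of the Dirichlet-type integral `∫ sin (q β / 2) / sin (β / 2) dβ`. -/
noncomputable def dirichletTail (q : ℤ) (ε : ℝ) : ℝ :=
  ∫ β in ε..Real.pi, Real.sin (q * (β / 2)) / Real.sin (β / 2)

/-- The value of `∫ β in 0..π, sin (n β / 2) / sin (β / 2)`. -/
noncomputable def dirichletVal : ℕ → ℝ
  | 0 => 0
  | 1 => Real.pi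
  | n + 2 => dirichletVal n + 4 / (n + 1) * Real.sin ((n + 1) * (Real.pi / 2))

theorem continuousOn_div_sin_half {h : ℝ → ℝ} (hh : Continuous h) :
    ContinuousOn (fun β => h β / Real.sin (β / 2)) (Set.Ioc 0 Real.pi) :=
  hh.continuousOn.div (by fun_prop) fun _ hβ => sin_half_ne_zero hβ.1 hβ.2

theorem uIcc_subset_Ioc_pi {a b : ℝ} (ha : 0 < a) (ha' : a ≤ Real.pi) (hb : 0 < b)
    (hb' : b ≤ Real.pi) : Set.uIcc a b ⊆ Set.Ioc 0 Real.pi :=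
  fun _ hx => ⟨(lt_min ha hb).trans_le hx.1, hx.2.trans (max_le ha' hb')⟩

theorem intervalIntegrable_div_sin_half {h : ℝ → ℝ} (hh : Continuous h) {a b : ℝ} (ha : 0 < a)
    (ha' : a ≤ Real.pi) (hb : 0 < b) (hb' : b ≤ Real.pi) :
    IntervalIntegrable (fun β => h β / Real.sin (β / 2)) volume a b :=
  ((continuousOn_div_sin_half hh).mono (uIcc_subset_Ioc_pi ha ha' hb hb')).intervalIntegrable

theorem dirichletTail_neg (q : ℤ) (ε : ℝ) : dirichletTail (-q) ε = -dirichletTail q ε := by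
  rw [dirichletTail, dirichletTail, ← intervalIntegral.integral_neg]
  refine intervalIntegral.integral_congr fun β _ => ?_
  simp [neg_div]

theorem dirichletTail_add_two (n : ℕ) {ε : ℝ} (h0 : 0 < ε) (hpi : ε ≤ Real.pi) :
    dirichletTail (n + 2 : ℕ) ε = dirichletTail n ε +
      4 / (n + 1) * (Real.sin ((n + 1) * (Real.pi / 2)) - Real.sin ((n + 1) * (ε / 2))) := by
  have hn : (n + 1 : ℝ) ≠ 0 := by positivity
  have hder : ∀ β ∈ Set.uIcc ε Real.pi,
      HasDerivAt (fun β => 4 / (n + 1 : ℝ) * Real.sin ((n + 1) * (β / 2)))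
        (2 * Real.cos ((n + 1) * (β / 2))) β := by
    intro β _
    have h := ((((hasDerivAt_id β).div_const 2).const_mul (n + 1 : ℝ)).sin).const_mul
      (4 / (n + 1 : ℝ))
    convert! h using 1
    simp only [id]
    field_simp
    ring
  have hcos := intervalIntegral.integral_eq_sub_of_hasDerivAt hder
    ((by fun_prop : Continuous fun β : ℝ => 2 * Real.cos ((n + 1) * (β / 2))).intervalIntegrable _ _)
  rw [mul_sub, ← hcos, dirichletTail, dirichletTail, ← intervalIntegral.integral_add
    (intervalIntegrable_div_sin_half (by fun_prop) h0 hpi Real.pi_pos le_rfl)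
    ((by fun_prop : Continuous fun β : ℝ => 2 * Real.cos ((n + 1) * (β / 2))).intervalIntegrable _ _)]
  refine intervalIntegral.integral_congr fun β hβ => ?_
  have hβ' := uIcc_subset_Ioc_pi h0 hpi Real.pi_pos le_rfl hβ
  have hs := sin_half_ne_zero hβ'.1 hβ'.2
  rw [div_add' _ _ _ hs]
  congr 1
  have e1 : ((n + 2 : ℕ) : ℤ) * (β / 2) = (n + 1) * (β / 2) + β / 2 := by push_cast; ring
  have e2 : ((n : ℤ) : ℝ) * (β / 2) = (n + 1) * (β / 2) - β / 2 := by push_cast; ring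
  rw [e1, e2, Real.sin_add, Real.sin_sub]
  ring

theorem tendsto_dirichletTail_natCast (n : ℕ) :
    Tendsto (dirichletTail n) (nhdsWithin 0 (Set.Ioi 0)) (nhds (dirichletVal n)) := by
  have hmem : Set.Ioc 0 Real.pi ∈ nhdsWithin (0 : ℝ) (Set.Ioi 0) := Ioc_mem_nhdsGT Real.pi_pos
  induction n using dirichletVal.induct with
  | case1 =>
    refine tendsto_const_nhds.congr fun ε => ?_
    simp [dirichletTail, dirichletVal]
  | case2 =>
    have h : Tendsto (fun ε : ℝ => Real.pi - ε) (nhdsWithin 0 (Set.Ioi 0)) (nhds (dirichletVal 1)) := by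
      have : Continuous fun ε : ℝ => Real.pi - ε := by fun_prop
      simpa [dirichletVal] using (this.tendsto 0).mono_left nhdsWithin_le_nhds
    refine h.congr' (eventually_of_mem hmem fun ε hε => ?_)
    have : dirichletTail (1 : ℕ) ε = ∫ _ in ε..Real.pi, (1 : ℝ) := by
      refine intervalIntegral.integral_congr fun β hβ => ?_
      have hβ' := uIcc_subset_Ioc_pi hε.1 hε.2 Real.pi_pos le_rfl hβ
      simpa using div_self (sin_half_ne_zero hβ'.1 hβ'.2)
    rw [this]
    simp
  | case3 n ih =>
    have h : Tendsto (fun ε : ℝ => dirichletTail n ε +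
        4 / (n + 1) * (Real.sin ((n + 1) * (Real.pi / 2)) - Real.sin ((n + 1) * (ε / 2))))
        (nhdsWithin 0 (Set.Ioi 0)) (nhds (dirichletVal (n + 2))) := by
      rw [dirichletVal]
      refine ih.add ?_
      have : Continuous fun ε : ℝ =>
        4 / (n + 1 : ℝ) * (Real.sin ((n + 1) * (Real.pi / 2)) - Real.sin ((n + 1) * (ε / 2))) := by
        fun_prop
      simpa using (this.tendsto 0).mono_left nhdsWithin_le_nhds
    exact h.congr' (eventually_of_mem hmem fun ε hε => (dirichletTail_add_two n hε.1 hε.2).symm)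

theorem abs_sin_natCast_mul_le (n : ℕ) (x : ℝ) : |Real.sin (n * x)| ≤ n * |Real.sin x| := by
  induction n with
  | zero => simp
  | succ n ih =>
    push_cast
    rw [add_mul, one_mul, Real.sin_add]
    have h1 : |Real.sin (n * x) * Real.cos x| ≤ |Real.sin (n * x)| := by
      rw [abs_mul]
      exact mul_le_of_le_one_right (abs_nonneg _) (Real.abs_cos_le_one x)
    have h2 : |Real.cos (n * x) * Real.sin x| ≤ |Real.sin x| := by
      rw [abs_mul]
      exact mul_le_of_le_one_left (abs_nonneg _) (Real.abs_cos_le_one _)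
    have := abs_add_le (Real.sin (n * x) * Real.cos x) (Real.cos (n * x) * Real.sin x)
    linarith

/-- Integration by parts bounds the tail of the Dirichlet integral. -/
theorem abs_dirichletTail_le {n : ℕ} (hn : 0 < n) {ε : ℝ} (h0 : 0 < ε) (hpi : ε ≤ Real.pi) :
    |dirichletTail n ε| ≤ 4 / (n * Real.sin (ε / 2)) := by
  have hn' : (0 : ℝ) < n := by exact_mod_cast hn
  have hs : ∀ β ∈ Set.uIcc ε Real.pi, Real.sin (β / 2) ≠ 0 := fun β hβ => by
    have hβ' := uIcc_subset_Ioc_pi h0 hpi Real.pi_pos le_rfl hβ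
    exact sin_half_ne_zero hβ'.1 hβ'.2
  have hsε : 0 < Real.sin (ε / 2) := Real.sin_pos_of_pos_of_lt_pi (by linarith) (by linarith)
  have hder1 : ∀ β ∈ Set.uIcc ε Real.pi,
      HasDerivAt (fun β => -(2 / n) * (Real.cos (n * (β / 2)) / Real.sin (β / 2)))
        (Real.sin (n * (β / 2)) / Real.sin (β / 2) +
          Real.cos (n * (β / 2)) * Real.cos (β / 2) / (n * Real.sin (β / 2) ^ 2)) β := by
    intro β hβ
    have hx := (hasDerivAt_id β).div_const 2
    have h := ((hx.const_mul (n : ℝ)).cos.div hx.sin (hs β hβ)).const_mul (-(2 / n : ℝ))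
    convert! h using 1
    have := hs β hβ
    simp only [id]
    field_simp
    ring
  have hder2 : ∀ β ∈ Set.uIcc ε Real.pi,
      HasDerivAt (fun β => -(2 / n) * (1 / Real.sin (β / 2)))
        (Real.cos (β / 2) / (n * Real.sin (β / 2) ^ 2)) β := by
    intro β hβ
    have hx := (hasDerivAt_id β).div_const 2
    have h := ((hasDerivAt_const β (1 : ℝ)).div hx.sin (hs β hβ)).const_mul (-(2 / n : ℝ))
    convert! h using 1
    have := hs β hβ
    simp only [id]
    field_simp
    ring
  have hi1 : IntervalIntegrable (fun β => Real.sin (n * (β / 2)) / Real.sin (β / 2)) volume ε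
      Real.pi := intervalIntegrable_div_sin_half (by fun_prop) h0 hpi Real.pi_pos le_rfl
  have hne : ∀ β ∈ Set.uIcc ε Real.pi, (n : ℝ) * Real.sin (β / 2) ^ 2 ≠ 0 := fun β hβ =>
    mul_ne_zero hn'.ne' (pow_ne_zero 2 (hs β hβ))
  have hi2 : IntervalIntegrable (fun β => Real.cos (n * (β / 2)) * Real.cos (β / 2) /
      (n * Real.sin (β / 2) ^ 2)) volume ε Real.pi :=
    ContinuousOn.intervalIntegrable (ContinuousOn.div (by fun_prop) (by fun_prop) hne)
  have hi3 : IntervalIntegrable (fun β => Real.cos (β / 2) /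
      (n * Real.sin (β / 2) ^ 2)) volume ε Real.pi :=
    ContinuousOn.intervalIntegrable (ContinuousOn.div (by fun_prop) (by fun_prop) hne)
  have e1 := intervalIntegral.integral_eq_sub_of_hasDerivAt hder1 (hi1.add hi2)
  have e2 := intervalIntegral.integral_eq_sub_of_hasDerivAt hder2 hi3
  rw [intervalIntegral.integral_add hi1 hi2] at e1
  have hle : |∫ β in ε..Real.pi, Real.cos (n * (β / 2)) * Real.cos (β / 2) /
      (n * Real.sin (β / 2) ^ 2)| ≤ ∫ β in ε..Real.pi, Real.cos (β / 2) /
      (n * Real.sin (β / 2) ^ 2) := by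
    rw [← Real.norm_eq_abs]
    refine intervalIntegral.norm_integral_le_of_norm_le hpi (ae_of_all _ fun β hβ => ?_) hi3
    have hc : 0 ≤ Real.cos (β / 2) :=
      Real.cos_nonneg_of_neg_pi_div_two_le_of_le (by linarith [hβ.1]) (by linarith [hβ.2])
    rw [Real.norm_eq_abs, mul_div_assoc, abs_mul, abs_of_nonneg (a := _ / _) (by positivity)]
    exact mul_le_of_le_one_left (by positivity) (Real.abs_cos_le_one _)
  rw [e2] at hle
  have e3 : dirichletTail n ε = ∫ β in ε..Real.pi, Real.sin (n * (β / 2)) / Real.sin (β / 2) := by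
    simp [dirichletTail]
  rw [e3]
  rw [Real.sin_pi_div_two] at e1 hle
  have b1 : |(2 / n : ℝ) * (Real.cos (n * (Real.pi / 2)) / 1)| ≤ 2 / n := by
    rw [abs_mul, div_one, abs_of_pos (by positivity : (0 : ℝ) < 2 / n)]
    exact mul_le_of_le_one_right (by positivity) (Real.abs_cos_le_one _)
  have b2 : |(2 / n : ℝ) * (Real.cos (n * (ε / 2)) / Real.sin (ε / 2))| ≤
      2 / n * (1 / Real.sin (ε / 2)) := by
    rw [abs_mul, abs_of_pos (by positivity : (0 : ℝ) < 2 / n), abs_div, abs_of_pos hsε]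
    gcongr
    exact Real.abs_cos_le_one _
  have e4 : 4 / (n * Real.sin (ε / 2)) = 2 * (2 / n * (1 / Real.sin (ε / 2))) := by
    field_simp
    ring
  rw [e4]
  rw [abs_le] at *
  constructor <;> linarith [hle.1, hle.2, b1.1, b1.2, b2.1, b2.2]

theorem abs_dirichletTail_natCast_le (n : ℕ) {ε : ℝ} (h0 : 0 < ε) (hpi : ε ≤ Real.pi) :
    |dirichletTail n ε| ≤ 4 * Real.pi + 1 := by
  rcases Nat.eq_zero_or_pos n with rfl | hn
  · simp [dirichletTail]
    positivity
  have hn1 : (1 : ℝ) ≤ n := by exact_mod_cast hn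
  have hn' : (0 : ℝ) < n := by linarith
  have hfar : ∀ δ : ℝ, 1 / n ≤ δ → δ ≤ Real.pi → |dirichletTail n δ| ≤ 4 * Real.pi := by
    intro δ hδ hδpi
    have hδ0 : 0 < δ := lt_of_lt_of_le (by positivity) hδ
    refine (abs_dirichletTail_le hn hδ0 hδpi).trans ?_
    have hsin := Real.mul_le_sin (x := δ / 2) (by linarith) (by linarith)
    have hsin' : 1 / Real.pi ≤ n * Real.sin (δ / 2) := by
      calc 1 / Real.pi = n * (2 / Real.pi * ((1 / n) / 2)) := by field_simp
        _ ≤ n * (2 / Real.pi * (δ / 2)) := by gcongr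
        _ ≤ _ := by gcongr
    calc 4 / (n * Real.sin (δ / 2)) ≤ 4 / (1 / Real.pi) := by gcongr
      _ = 4 * Real.pi := by field_simp
  rcases le_total (1 / n : ℝ) ε with h | h
  · linarith [hfar ε h hpi]
  have h1pi : (1 / n : ℝ) ≤ Real.pi := by
    have : (1 / n : ℝ) ≤ 1 := by rw [div_le_one hn']; exact hn1
    linarith [Real.pi_gt_three]
  have hpos : (0 : ℝ) < 1 / n := by positivity
  have hcts : Continuous fun β : ℝ => Real.sin (((n : ℤ) : ℝ) * (β / 2)) := by fun_prop
  have hsplit : dirichletTail n ε =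
      (∫ β in ε..1 / n, Real.sin (((n : ℤ) : ℝ) * (β / 2)) / Real.sin (β / 2)) +
        dirichletTail n (1 / n) :=
    (intervalIntegral.integral_add_adjacent_intervals
      (intervalIntegrable_div_sin_half hcts h0 hpi hpos h1pi)
      (intervalIntegrable_div_sin_half hcts hpos h1pi Real.pi_pos le_rfl)).symm
  have hnear : |∫ β in ε..1 / n, Real.sin (((n : ℤ) : ℝ) * (β / 2)) / Real.sin (β / 2)| ≤
      n * |1 / n - ε| := by
    rw [← Real.norm_eq_abs]
    refine intervalIntegral.norm_integral_le_of_norm_le_const fun β hβ => ?_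
    have hβ' := uIcc_subset_Ioc_pi h0 hpi hpos h1pi (Set.uIoc_subset_uIcc hβ)
    rw [Real.norm_eq_abs, abs_div, div_le_iff₀ (abs_pos.mpr (sin_half_ne_zero hβ'.1 hβ'.2))]
    simpa using abs_sin_natCast_mul_le n (β / 2)
  have hnear' : n * |1 / n - ε| ≤ 1 := by
    rw [abs_of_nonneg (by linarith)]
    calc n * (1 / n - ε) ≤ n * (1 / n) := by gcongr; linarith
      _ = 1 := by field_simp
  rw [hsplit]
  have := abs_add_le (∫ β in ε..1 / n, Real.sin (((n : ℤ) : ℝ) * (β / 2)) / Real.sin (β / 2))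
    (dirichletTail n (1 / n))
  linarith [hfar _ le_rfl h1pi]

theorem abs_dirichletTail_intCast_le (q : ℤ) {ε : ℝ} (h0 : 0 < ε) (hpi : ε ≤ Real.pi) :
    |dirichletTail q ε| ≤ 4 * Real.pi + 1 := by
  obtain ⟨n, rfl | rfl⟩ := q.eq_nat_or_neg
  · exact abs_dirichletTail_natCast_le n h0 hpi
  · rw [dirichletTail_neg, abs_neg]
    exact abs_dirichletTail_natCast_le n h0 hpi

theorem tendsto_dirichletTail (q : ℤ) :
    Tendsto (dirichletTail q) (nhdsWithin 0 (Set.Ioi 0))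
      (nhds (q.sign * dirichletVal q.natAbs)) := by
  rcases lt_trichotomy q 0 with h | rfl | h
  · have hq : q = -(q.natAbs : ℤ) := by omega
    rw [Int.sign_eq_neg_one_of_neg h]
    have := (tendsto_dirichletTail_natCast q.natAbs).neg
    simp_rw [← dirichletTail_neg, ← hq] at this
    simpa using this
  · simpa [dirichletVal] using tendsto_dirichletTail_natCast 0
  · have hq : q = (q.natAbs : ℤ) := by omega
    rw [Int.sign_eq_one_of_pos h]
    have := tendsto_dirichletTail_natCast q.natAbs
    simp_rw [← hq] at this
    simpa using this

theorem dirichletVal_odd (m : ℕ) : dirichletVal (2 * m + 1) = Real.pi := by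
  induction m with
  | zero => simp [dirichletVal]
  | succ m ih =>
    rw [show 2 * (m + 1) + 1 = (2 * m + 1) + 2 by ring, dirichletVal, ih]
    have : ((2 * m + 1 : ℕ) + 1 : ℝ) * (Real.pi / 2) = (m + 1 : ℕ) * Real.pi := by push_cast; ring
    rw [this, Real.sin_nat_mul_pi]
    simp

theorem dirichletVal_four_mul_add_two (m : ℕ) :
    dirichletVal (4 * m + 2) = dirichletVal (4 * m) + 4 / (4 * m + 1) := by
  rw [dirichletVal]
  have : ((4 * m : ℕ) + 1 : ℝ) * (Real.pi / 2) = Real.pi / 2 + m * (2 * Real.pi) := by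
    push_cast; ring
  rw [this, Real.sin_add_nat_mul_two_pi, Real.sin_pi_div_two]
  push_cast
  ring

theorem dirichletVal_four_mul_add_four (m : ℕ) :
    dirichletVal (4 * (m + 1)) = dirichletVal (4 * m) + 4 / (4 * m + 1) - 4 / (4 * m + 3) := by
  rw [show 4 * (m + 1) = (4 * m + 2) + 2 by ring, dirichletVal, dirichletVal_four_mul_add_two]
  have : ((4 * m + 2 : ℕ) + 1 : ℝ) * (Real.pi / 2) =
      Real.pi / 2 + Real.pi + m * (2 * Real.pi) := by
    push_cast; ring
  rw [this, Real.sin_add_nat_mul_two_pi, Real.sin_add_pi, Real.sin_pi_div_two]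
  push_cast
  ring

theorem dirichletVal_four_mul_mem (m : ℕ) : 0 ≤ dirichletVal (4 * m) ∧
    dirichletVal (4 * m) ≤ 10 / 3 + 2 / (4 * m + 3) - 4 / (4 * m + 1) := by
  induction m with
  | zero => norm_num [dirichletVal]
  | succ m ih =>
    rw [dirichletVal_four_mul_add_four]
    have h1 : (4 : ℝ) / (4 * m + 3) ≤ 4 / (4 * m + 1) := by gcongr; norm_num
    have h2 : (0 : ℝ) ≤ 2 / (4 * m + 3) + 2 / (4 * m + 7) - 4 / (4 * m + 5) := by
      have : (2 : ℝ) / (4 * m + 3) + 2 / (4 * m + 7) - 4 / (4 * m + 5) =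
          16 / ((4 * m + 3) * (4 * m + 7) * (4 * m + 5)) := by
        field_simp
        ring
      rw [this]
      positivity
    have e : (4 : ℝ) / (4 * m + 3) = 2 * (2 / (4 * m + 3)) := by ring
    push_cast
    rw [show (4 * ((m : ℝ) + 1) + 3) = 4 * m + 7 by ring,
      show (4 * ((m : ℝ) + 1) + 1) = 4 * m + 5 by ring]
    constructor <;> linarith [ih.1, ih.2]

theorem dirichletVal_mem (n : ℕ) : 0 ≤ dirichletVal n ∧ dirichletVal n ≤ 4 := by
  obtain ⟨m, rfl | rfl | rfl⟩ : ∃ m, n = 4 * m ∨ n = 4 * m + 2 ∨ n = 2 * m + 1 := by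
    rcases Nat.even_or_odd' n with ⟨k, rfl | rfl⟩
    · rcases Nat.even_or_odd' k with ⟨m, rfl | rfl⟩
      · exact ⟨m, by omega⟩
      · exact ⟨m, by omega⟩
    · exact ⟨k, by omega⟩
  all_goals
    have h := dirichletVal_four_mul_mem m
    have h2 : (0 : ℝ) ≤ 4 / (4 * m + 1) := by positivity
    have h3 : (2 : ℝ) / (4 * m + 3) ≤ 2 / 3 := by gcongr; linarith [m.cast_nonneg (α := ℝ)]
  · constructor <;> linarith [h.1, h.2]
  · rw [dirichletVal_four_mul_add_two]
    constructor <;> linarith [h.1, h.2]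
  · rw [dirichletVal_odd]
    exact ⟨Real.pi_pos.le, Real.pi_le_four⟩

theorem dirichletVal_add_le (n : ℕ) : dirichletVal n + dirichletVal (n + 2) ≤ 20 / 3 := by
  obtain ⟨m, rfl | rfl | rfl⟩ : ∃ m, n = 4 * m ∨ n = 4 * m + 2 ∨ n = 2 * m + 1 := by
    rcases Nat.even_or_odd' n with ⟨k, rfl | rfl⟩
    · rcases Nat.even_or_odd' k with ⟨m, rfl | rfl⟩
      · exact ⟨m, by omega⟩
      · exact ⟨m, by omega⟩
    · exact ⟨k, by omega⟩
  all_goals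
    have h := dirichletVal_four_mul_mem m
    have h2 : (4 : ℝ) / (4 * m + 3) ≤ 4 / (4 * m + 1) := by gcongr; norm_num
    have e : (4 : ℝ) / (4 * m + 3) = 2 * (2 / (4 * m + 3)) := by ring
  · rw [dirichletVal_four_mul_add_two]
    linarith [h.1, h.2]
  · rw [show 4 * m + 2 + 2 = 4 * (m + 1) by ring, dirichletVal_four_mul_add_four,
      dirichletVal_four_mul_add_two]
    linarith [h.1, h.2]
  · rw [show 2 * m + 1 + 2 = 2 * (m + 1) + 1 by ring, dirichletVal_odd, dirichletVal_odd]
    linarith [Real.pi_lt_d2]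

theorem oddKernel_sin : OddKernel (fun β => 1 / (2 * Real.sin (β / 2)))
    (fun q => q.sign * dirichletVal q.natAbs) 4 := by
  have key : ∀ (q : ℤ) (ε : ℝ), ∫ β in ε..Real.pi, 2 * Real.sin (q * (β / 2)) *
      (1 / (2 * Real.sin (β / 2))) = dirichletTail q ε := by
    intro q ε
    refine intervalIntegral.integral_congr fun β _ => ?_
    rw [mul_one_div, mul_div_mul_left _ _ two_ne_zero]
  refine ⟨fun β => ?_, ?_, ⟨4 * Real.pi + 1, fun q ε h0 hpi => ?_⟩, fun q => ?_, fun q => ?_⟩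
  · simp [neg_div]
  · convert! continuousOn_div_sin_half (h := fun _ => 1 / 2) continuous_const using 2 with β
    rw [div_div]
  · rw [key]
    exact abs_dirichletTail_intCast_le q h0 hpi
  · simp_rw [key]
    exact tendsto_dirichletTail q
  · have h := dirichletVal_mem q.natAbs
    rw [abs_mul, abs_of_nonneg h.1]
    refine (mul_le_of_le_one_left h.1 ?_).trans h.2
    rcases lt_trichotomy q 0 with h | rfl | h
    · simp [Int.sign_eq_neg_one_of_neg h]
    · simp
    · simp [Int.sign_eq_one_of_pos h]

theorem oddKernel_tan : OddKernel (fun β => 1 / (2 * Real.tan (β / 2)))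
    (fun q => ((q + 1).sign * dirichletVal (q + 1).natAbs +
      (q - 1).sign * dirichletVal (q - 1).natAbs) / 2) (10 / 3) := by
  have hK : ∀ β : ℝ, 1 / (2 * Real.tan (β / 2)) = (Real.cos (β / 2) / 2) / Real.sin (β / 2) := by
    intro β
    rw [Real.tan_eq_sin_div_cos, mul_div_assoc', one_div_div, div_div]
  have key : ∀ (q : ℤ) (ε : ℝ), 0 < ε → ε ≤ Real.pi →
      ∫ β in ε..Real.pi, 2 * Real.sin (q * (β / 2)) * (1 / (2 * Real.tan (β / 2))) =
        (dirichletTail (q + 1) ε + dirichletTail (q - 1) ε) / 2 := by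
    intro q ε h0 hpi
    rw [dirichletTail, dirichletTail, ← intervalIntegral.integral_add
      (intervalIntegrable_div_sin_half (by fun_prop) h0 hpi Real.pi_pos le_rfl)
      (intervalIntegrable_div_sin_half (by fun_prop) h0 hpi Real.pi_pos le_rfl),
      ← intervalIntegral.integral_div]
    refine intervalIntegral.integral_congr fun β _ => ?_
    simp only [hK]
    push_cast
    rw [add_mul, sub_mul, one_mul, Real.sin_add, Real.sin_sub]
    ring
  have hmem : Set.Ioc 0 Real.pi ∈ nhdsWithin (0 : ℝ) (Set.Ioi 0) := Ioc_mem_nhdsGT Real.pi_pos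
  have hnat : ∀ n : ℕ, |(((n : ℤ) + 1).sign * dirichletVal ((n : ℤ) + 1).natAbs +
      ((n : ℤ) - 1).sign * dirichletVal ((n : ℤ) - 1).natAbs) / 2| ≤ 10 / 3 := by
    rintro (_ | _ | n)
    · norm_num
    · norm_num [dirichletVal, show Int.sign 2 = 1 from rfl]
    · have h1 : ((n + 1 + 1 : ℕ) : ℤ) + 1 = ((n + 1 + 2 : ℕ) : ℤ) := by push_cast; ring
      have h2 : ((n + 1 + 1 : ℕ) : ℤ) - 1 = ((n + 1 : ℕ) : ℤ) := by push_cast; ring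
      rw [h1, h2, Int.sign_natCast_of_ne_zero (by omega), Int.sign_natCast_of_ne_zero (by omega),
        Int.natAbs_natCast, Int.natAbs_natCast, abs_le]
      have := dirichletVal_add_le (n + 1)
      have := (dirichletVal_mem (n + 1)).1
      have := (dirichletVal_mem (n + 1 + 2)).1
      push_cast
      constructor <;> linarith
  refine ⟨fun β => ?_, ?_, ⟨4 * Real.pi + 1, fun q ε h0 hpi => ?_⟩, fun q => ?_, fun q => ?_⟩
  · simp [neg_div]
  · simp_rw [hK]
    exact continuousOn_div_sin_half (by fun_prop)
  · rw [key q ε h0 hpi]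
    have h1 := abs_le.mp (abs_dirichletTail_intCast_le (q + 1) h0 hpi)
    have h2 := abs_le.mp (abs_dirichletTail_intCast_le (q - 1) h0 hpi)
    rw [abs_le]
    constructor <;> linarith [h1.1, h1.2, h2.1, h2.2]
  · refine Tendsto.congr' (eventually_of_mem hmem fun ε hε => (key q ε hε.1 hε.2).symm) ?_
    exact ((tendsto_dirichletTail (q + 1)).add (tendsto_dirichletTail (q - 1))).div_const 2
  · obtain ⟨n, rfl | rfl⟩ := q.eq_nat_or_neg
    · exact hnat n
    · have h1 : -(n : ℤ) + 1 = -((n : ℤ) - 1) := by ring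
      have h2 : -(n : ℤ) - 1 = -((n : ℤ) + 1) := by ring
      rw [h1, h2, Int.natAbs_neg, Int.natAbs_neg, Int.sign_neg, Int.sign_neg, ← abs_neg]
      convert! hnat n using 2
      push_cast
      ring

theorem hasTrigRep_prodKer {n : ℕ} (l : ℕ) {f : Fin n → ℝ → ℂ}
    (hper : ∀ j, Function.Periodic (f j) (2 * Real.pi)) (hcont : ∀ j, Continuous (f j))
    (hsum : ∀ j, Summable fun k : ℤ => ‖cFourierCoef (f j) k‖)
    (hsum' : ∀ j, Summable fun k : ℤ => |(k : ℝ)| * ‖cFourierCoef (f j) k‖) :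
    HasTrigRep (prodKer n l f) (convBound n l f) := by
  refine HasTrigRep.prod fun j => ?_
  by_cases hj : (j : ℕ) < l
  · simpa only [hj, if_true] using hasTrigRep_shift (hper j) (hcont j) (hsum j)
  · simpa only [hj, if_false] using hasTrigRep_deltaBeta (hper j) (hcont j) (hsum j) (hsum' j)

/-- Lemma 3.2: the principal values defining `I` and `J` exist at every point, and
their Fourier coefficients are bounded by `4` (resp. `10/3`) times the convolution
of the coefficient sequences `|f̂_j|` (first group) and `|k||f̂_j|` (second group). -/
theorem fourier_coefficient_convolution_bound (n l : ℕ) (hl : l ≤ n)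
    (f : Fin n → ℝ → ℂ) (hper : ∀ j, Function.Periodic (f j) (2 * Real.pi))
    (hcont : ∀ j, Continuous (f j))
    (hsum : ∀ j, Summable fun k : ℤ => ‖cFourierCoef (f j) k‖)
    (hsum' : ∀ j, Summable fun k : ℤ => |(k : ℝ)| * ‖cFourierCoef (f j) k‖) :
    ((∀ α : ℝ, ∃ L : ℂ, Tendsto (fun ε => pvSinApprox n l f α ε)
        (nhdsWithin 0 (Set.Ioi 0)) (nhds L)) ∧
      (∀ α : ℝ, ∃ L : ℂ, Tendsto (fun ε => pvTanApprox n l f α ε)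
        (nhdsWithin 0 (Set.Ioi 0)) (nhds L))) ∧
    (∀ I : ℝ → ℂ, (∀ α : ℝ, Tendsto (fun ε => pvSinApprox n l f α ε)
        (nhdsWithin 0 (Set.Ioi 0)) (nhds (I α))) →
      ∀ k : ℤ, ENNReal.ofReal (‖cFourierCoef I k‖) ≤ 4 * convBound n l f k) ∧
    (∀ J : ℝ → ℂ, (∀ α : ℝ, Tendsto (fun ε => pvTanApprox n l f α ε)
        (nhdsWithin 0 (Set.Ioi 0)) (nhds (J α))) →
      ∀ k : ℤ, ENNReal.ofReal (‖cFourierCoef J k‖) ≤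
        ENNReal.ofReal (10 / 3) * convBound n l f k) := by
  have hG := hasTrigRep_prodKer l hper hcont hsum hsum'
  obtain ⟨F, hF, hFB⟩ := hG.tendsto_truncIntegral oddKernel_sin
  obtain ⟨H, hH, hHB⟩ := hG.tendsto_truncIntegral oddKernel_tan
  have hsin : ∀ α, pvSinApprox n l f α =
      truncIntegral (fun β => 1 / (2 * Real.sin (β / 2))) (prodKer n l f α) := by
    intro α
    funext ε
    simp only [pvSinApprox, truncIntegral, Complex.ofReal_div, Complex.ofReal_one, mul_one_div]
  have htan : ∀ α, pvTanApprox n l f α =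
      truncIntegral (fun β => 1 / (2 * Real.tan (β / 2))) (prodKer n l f α) := by
    intro α
    funext ε
    simp only [pvTanApprox, truncIntegral, Complex.ofReal_div, Complex.ofReal_one, mul_one_div]
  simp_rw [← hsin] at hF
  simp_rw [← htan] at hH
  refine ⟨⟨fun α => ⟨F α, hF α⟩, fun α => ⟨H α, hH α⟩⟩, fun I hI k => ?_, fun J hJ k => ?_⟩
  · rw [show I = F from funext fun α => tendsto_nhds_unique (hI α) (hF α)]
    simpa using hFB k
  · rw [show J = H from funext fun α => tendsto_nhds_unique (hJ α) (hH α)]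
    exact hHB k
end

section
/- Let f ∈ L²(𝕋;ℝ) satisfy the area-conservation identity ∫_𝕋 f(α) dα = −(1/2)∫_𝕋 f(α)² dα and assume f̂(0) > −1, where f̂(0) = (1/2π)∫_𝕋 f(α) dα. Then Σ_{k∈ℤ∖{0}} |f̂(k)|² ≤ 1 and f̂(0) = −1 + √(1 − Σ_{k∈ℤ∖{0}} |f̂(k)|²); equivalently, f̂(0) = −1 + √(1 − (1/2π)‖ℙf‖²_{L²}), where ℙf = f − f̂(0). -/
open MeasureTheory Filter

/-- The `k`-th Fourier coefficient of a `2π`-periodic function `f : ℝ → ℝ`. -/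
noncomputable def fourierCoef (f : ℝ → ℝ) (k : ℤ) : ℂ :=
  (1 / (2 * Real.pi)) * ∫ α in (-Real.pi)..Real.pi, (f α : ℂ) * Complex.exp (-Complex.I * k * α)

/-- The homogeneous analytic Wiener seminorm `‖f‖_{Ḟ^{s,1}_ν}` at time `t`,
valued in `[0,∞]`. -/
noncomputable def wienerNorm (ν t s : ℝ) (f : ℝ → ℝ) : ENNReal :=
  ∑' k : ℤ, if k = 0 then 0 else
    ENNReal.ofReal (Real.exp (ν * |(k : ℝ)| * t) * |(k : ℝ)| ^ s *
      ‖fourierCoef f k‖)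

/-- If the integral of `f` is `-1/2` times the integral of `f²` and `f²` is integrable, then `f` is
square integrable: a function with non-integrable `f` has integral zero, so it vanishes a.e. -/
theorem memLp_two_of_integral_eq {X : Type*} [MeasurableSpace X] {μ : Measure X} {f : X → ℝ}
    (hf : Integrable (fun x => (f x) ^ 2) μ)
    (h : ∫ x, f x ∂μ = -(1 / 2) * ∫ x, (f x) ^ 2 ∂μ) : MemLp f 2 μ := by
  have hm : AEStronglyMeasurable f μ := by
    by_cases hi : Integrable f μ
    · exact hi.aestronglyMeasurable
    · rw [integral_undef hi] at h
      have h0 : ∫ x, (f x) ^ 2 ∂μ = 0 := by linarith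
      rw [integral_eq_zero_iff_of_nonneg (fun x => sq_nonneg (f x)) hf] at h0
      have hz : f =ᵐ[μ] fun _ => (0 : ℝ) := by
        filter_upwards [h0] with x hx
        simpa using hx
      exact aestronglyMeasurable_const.congr hz.symm
  exact (memLp_two_iff_integrable_sq hm).2 hf

theorem fourierCoef_eq_fourierCoeffOn (f : ℝ → ℝ) (k : ℤ) :
    fourierCoef f k =
      fourierCoeffOn (neg_lt_self Real.pi_pos) (fun α => (f α : ℂ)) k := by
  rw [fourierCoeffOn_eq_integral, fourierCoef]
  have hπ : (Real.pi : ℂ) ≠ 0 := by exact_mod_cast Real.pi_ne_zero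
  rw [show Real.pi - -Real.pi = 2 * Real.pi by ring, Complex.real_smul]
  congr 1
  · push_cast; rfl
  · refine intervalIntegral.integral_congr fun x _ => ?_
    simp only [fourier_coe_apply, smul_eq_mul]
    rw [mul_comm]
    congr 2
    push_cast
    field_simp

theorem fourierCoef_zero (f : ℝ → ℝ) :
    fourierCoef f 0 = (((1 / (2 * Real.pi)) * ∫ α in (-Real.pi)..Real.pi, f α : ℝ) : ℂ) := by
  simp [fourierCoef, intervalIntegral.integral_ofReal]

theorem tsum_norm_sq_fourierCoef_ne_zero (f : ℝ → ℝ)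
    (hf : MemLp f 2 (volume.restrict (Set.Ioc (-Real.pi) Real.pi))) :
    (∑' k : ℤ, if k = 0 then (0 : ℝ) else ‖fourierCoef f k‖ ^ 2) =
      (1 / (2 * Real.pi)) * (∫ α in (-Real.pi)..Real.pi, (f α) ^ 2) -
        ((1 / (2 * Real.pi)) * ∫ α in (-Real.pi)..Real.pi, f α) ^ 2 := by
  have hs := hasSum_sq_fourierCoeffOn (neg_lt_self Real.pi_pos) (f := fun α => (f α : ℂ)) hf.ofReal
  simp only [← fourierCoef_eq_fourierCoeffOn] at hs
  have h := hs.summable.tsum_eq_add_tsum_ite 0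
  rw [hs.tsum_eq, fourierCoef_zero, Complex.norm_real, Real.norm_eq_abs, sq_abs] at h
  simp only [Complex.norm_real, Real.norm_eq_abs, sq_abs, smul_eq_mul, sub_neg_eq_add,
    ← two_mul, ← one_div] at h
  linarith

theorem integral_sub_mean_sq (f : ℝ → ℝ)
    (hf : MemLp f 2 (volume.restrict (Set.Ioc (-Real.pi) Real.pi))) :
    (1 / (2 * Real.pi)) * ∫ α in (-Real.pi)..Real.pi,
        (f α - (1 / (2 * Real.pi)) * ∫ y in (-Real.pi)..Real.pi, f y) ^ 2 =
      (1 / (2 * Real.pi)) * (∫ α in (-Real.pi)..Real.pi, (f α) ^ 2) -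
        ((1 / (2 * Real.pi)) * ∫ α in (-Real.pi)..Real.pi, f α) ^ 2 := by
  have hle : -Real.pi ≤ Real.pi := neg_le_self Real.pi_pos.le
  have h1 : IntervalIntegrable f volume (-Real.pi) Real.pi :=
    (intervalIntegrable_iff_integrableOn_Ioc_of_le hle).2 (hf.integrable one_le_two)
  have h2 : IntervalIntegrable (fun α => (f α) ^ 2) volume (-Real.pi) Real.pi :=
    (intervalIntegrable_iff_integrableOn_Ioc_of_le hle).2 hf.integrable_sq
  set m := (1 / (2 * Real.pi)) * ∫ y in (-Real.pi)..Real.pi, f y with hm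
  have hI : ∫ y in (-Real.pi)..Real.pi, f y = 2 * Real.pi * m := by
    rw [hm]
    field_simp
  have he : ∀ α, (f α - m) ^ 2 = (f α) ^ 2 - 2 * m * f α + m ^ 2 := fun α => by ring
  simp only [he]
  rw [intervalIntegral.integral_add (h2.sub (h1.const_mul _)) intervalIntegrable_const,
    intervalIntegral.integral_sub h2 (h1.const_mul _), intervalIntegral.integral_const_mul, hI,
    intervalIntegral.integral_const, smul_eq_mul]
  field_simp
  ring

/-- For a real `2π`-periodic `L²` function satisfying the area-conservation identity
`∫ f = −(1/2)∫ f²` and with mean `f̂(0) > −1`, the zero mode is determined by the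
remaining modes: `Σ_{k≠0}|f̂(k)|² ≤ 1` and
`f̂(0) = −1 + √(1 − Σ_{k≠0}|f̂(k)|²) = −1 + √(1 − (1/2π)‖ℙf‖²_{L²})`. -/
theorem zero_mode_determined (f : ℝ → ℝ) (hper : Function.Periodic f (2 * Real.pi))
    (hL2 : IntegrableOn (fun α => (f α) ^ 2) (Set.Ioc (-Real.pi) Real.pi))
    (harea : ∫ α in (-Real.pi)..Real.pi, f α =
      -(1 / 2) * ∫ α in (-Real.pi)..Real.pi, (f α) ^ 2)
    (hmean : -1 < (1 / (2 * Real.pi)) * ∫ α in (-Real.pi)..Real.pi, f α) :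
    (∑' k : ℤ, if k = 0 then (0 : ℝ) else (‖fourierCoef f k‖) ^ 2) ≤ 1 ∧
    (1 / (2 * Real.pi)) * (∫ α in (-Real.pi)..Real.pi, f α) =
      -1 + Real.sqrt (1 - ∑' k : ℤ,
        if k = 0 then (0 : ℝ) else (‖fourierCoef f k‖) ^ 2) ∧
    (1 / (2 * Real.pi)) * (∫ α in (-Real.pi)..Real.pi, f α) =
      -1 + Real.sqrt (1 - (1 / (2 * Real.pi)) * ∫ α in (-Real.pi)..Real.pi,
        (f α - (1 / (2 * Real.pi)) * ∫ y in (-Real.pi)..Real.pi, f y) ^ 2) := by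
  have hle : -Real.pi ≤ Real.pi := neg_le_self Real.pi_pos.le
  have hf : MemLp f 2 (volume.restrict (Set.Ioc (-Real.pi) Real.pi)) := by
    refine memLp_two_of_integral_eq hL2 ?_
    simpa only [intervalIntegral.integral_of_le hle] using harea
  rw [integral_sub_mean_sq f hf, tsum_norm_sq_fourierCoef_ne_zero f hf]
  have hsq : ∫ α in (-Real.pi)..Real.pi, (f α) ^ 2 =
      -2 * ∫ α in (-Real.pi)..Real.pi, f α := by linarith
  rw [hsq]
  set m := (1 / (2 * Real.pi)) * ∫ α in (-Real.pi)..Real.pi, f α with hm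
  have hv : (1 / (2 * Real.pi)) * (-2 * ∫ α in (-Real.pi)..Real.pi, f α) - m ^ 2 =
      1 - (1 + m) ^ 2 := by
    rw [mul_left_comm, ← hm]
    ring
  rw [hv, sub_sub_cancel, Real.sqrt_sq (by linarith)]
  refine ⟨by nlinarith [sq_nonneg (1 + m)], by ring, by ring⟩
end
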